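/- Let A = ℚ[u,v,w,x,y] and let σ_1 = u², σ_2 = u³v³ + u⁴vy² + u⁵vx² + u⁶w (= u³(v³ + (y² + ux²)uv + u³w)), σ_3 = u⁴v, σ_4 = u⁴y, σ_5 = u⁴x. Let L be the 5×5 matrix over A whose i-th row is (u·∂σ_i/∂u, ∂σ_i/∂v, ∂σ_i/∂w, ∂σ_i/∂x, ∂σ_i/∂y) (the logarithmic Jacobian matrix of σ with exceptional divisor (u=0)). Then det L = 2u²⁰, so the ideal of 5×5 minors of L is the principal monomial ideal (u²⁰); moreover, the ideal of A generated by all entries of L is the principal monomial ideal (u²). (Example 1.5: the logarithmic Fitting ideals F_0(σ) and F_4(σ) are principal at 0.) -/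

import Mathlib

open Matrix MvPolynomial

/-- The ideal of `r × r` minors of a matrix: the ideal generated by the determinants of all
`r × r` submatrices (obtained by selecting `r` rows and `r` columns). -/
def minorsIdeal {R : Type*} [CommRing R] {m c : Type*} (r : ℕ)
    (M : Matrix m c R) : Ideal R :=
  Ideal.span { d | ∃ (f : Fin r → m) (g : Fin r → c), d = (M.submatrix f g).det }

/-- Example 1.5: `σ_1 = u²`, `σ_2 = u³v³ + u⁴vy² + u⁵vx² + u⁶w`, `σ_3 = u⁴v`,
`σ_4 = u⁴y`, `σ_5 = u⁴x` (with `u = X 0`, `v = X 1`, `w = X 2`, `x = X 3`, `y = X 4`). -/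
noncomputable def σEx : Fin 5 → MvPolynomial (Fin 5) ℚ :=
  ![X 0 ^ 2,
    X 0 ^ 3 * X 1 ^ 3 + X 0 ^ 4 * X 1 * X 4 ^ 2 + X 0 ^ 5 * X 1 * X 3 ^ 2 + X 0 ^ 6 * X 2,
    X 0 ^ 4 * X 1,
    X 0 ^ 4 * X 4,
    X 0 ^ 4 * X 3]

/-- The logarithmic Jacobian matrix of `σEx`, with exceptional divisor `(u = 0)`:
the `i`-th row is `(u·∂σ_i/∂u, ∂σ_i/∂v, ∂σ_i/∂w, ∂σ_i/∂x, ∂σ_i/∂y)`. -/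
noncomputable def logJacEx : Matrix (Fin 5) (Fin 5) (MvPolynomial (Fin 5) ℚ) :=
  Matrix.of fun i =>
    ![X 0 * pderiv 0 (σEx i), pderiv 1 (σEx i), pderiv 2 (σEx i),
      pderiv 3 (σEx i), pderiv 4 (σEx i)]

theorem dvd_det_submatrix {R n : Type*} [CommRing R] [Fintype n] [DecidableEq n]
    (M : Matrix n n R) (f g : n → n) : M.det ∣ (M.submatrix f g).det := by
  have h : M.submatrix f g =
      (1 : Matrix n n R).submatrix f id * M * (1 : Matrix n n R).submatrix id g := by
    ext i j
    simp [Matrix.mul_apply, Matrix.one_apply]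
  rw [h, Matrix.det_mul, Matrix.det_mul]
  exact Dvd.intro_left _ rfl |>.mul_right _

theorem minorsIdeal_self {R : Type*} [CommRing R] {n : ℕ} (M : Matrix (Fin n) (Fin n) R) :
    minorsIdeal n M = Ideal.span {M.det} := by
  apply le_antisymm
  · refine Ideal.span_le.2 ?_
    rintro _ ⟨f, g, rfl⟩
    exact Ideal.mem_span_singleton.2 (dvd_det_submatrix M f g)
  · refine (Ideal.span_singleton_le_iff_mem _).2 (Ideal.subset_span ⟨id, id, ?_⟩)
    rw [Matrix.submatrix_id_id]

theorem isUnit_two_mvPolynomial {s : Type*} : IsUnit (2 : MvPolynomial s ℚ) := by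
  rw [← map_ofNat (C : ℚ →+* MvPolynomial s ℚ) 2]
  exact (IsUnit.mk0 (2 : ℚ) two_ne_zero).map C

theorem logJacEx_eq : logJacEx =
    !![2 * X 0 ^ 2, 0, 0, 0, 0;
      3 * X 0 ^ 3 * X 1 ^ 3 + 4 * X 0 ^ 4 * X 1 * X 4 ^ 2 + 5 * X 0 ^ 5 * X 1 * X 3 ^ 2
        + 6 * X 0 ^ 6 * X 2,
      3 * X 0 ^ 3 * X 1 ^ 2 + X 0 ^ 4 * X 4 ^ 2 + X 0 ^ 5 * X 3 ^ 2,
      X 0 ^ 6, 2 * X 0 ^ 5 * X 1 * X 3, 2 * X 0 ^ 4 * X 1 * X 4;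
      4 * X 0 ^ 4 * X 1, X 0 ^ 4, 0, 0, 0;
      4 * X 0 ^ 4 * X 4, 0, 0, 0, X 0 ^ 4;
      4 * X 0 ^ 4 * X 3, 0, 0, X 0 ^ 4, 0] := by
  ext1 i j
  fin_cases i <;> fin_cases j <;>
    simp [logJacEx, σEx, pderiv_X, Derivation.leibniz, Derivation.leibniz_pow] <;>
    ring

theorem det_logJacEx : logJacEx.det = 2 * X 0 ^ 20 := by
  rw [logJacEx_eq]
  simp [Matrix.det_succ_row_zero, Fin.sum_univ_succ, Fin.succAbove]
  ring

theorem X_sq_dvd_logJacEx (i j : Fin 5) : X 0 ^ 2 ∣ logJacEx i j := by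
  revert i j
  simp only [logJacEx_eq, Fin.forall_fin_succ, Fin.forall_fin_zero]
  have h (k : ℕ) (hk : 2 ≤ k) : (X 0 : MvPolynomial (Fin 5) ℚ) ^ 2 ∣ X 0 ^ k :=
    pow_dvd_pow _ hk
  have h' (k : ℕ) (hk : 2 ≤ k) (a : MvPolynomial (Fin 5) ℚ) : X 0 ^ 2 ∣ a * X 0 ^ k :=
    (h k hk).mul_left a
  simp
  with_reducible repeat' first
    | refine And.intro ?_ ?_
    | refine dvd_add ?_ ?_
    | exact h _ (by norm_num)
    | exact h' _ (by norm_num) _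
    | refine dvd_mul_of_dvd_left ?_ _

/-- Example 1.5: `det L = 2u²⁰`, so the logarithmic Fitting ideal `F_0(σ)` (the ideal of
`5 × 5` minors) is the principal monomial ideal `(u²⁰)`; and the ideal generated by all
entries of `L` (i.e. `F_4(σ)`) is the principal monomial ideal `(u²)`. -/
theorem F0_F4_example :
    logJacEx.det = 2 * X 0 ^ 20 ∧
      minorsIdeal 5 logJacEx = Ideal.span {(X 0 : MvPolynomial (Fin 5) ℚ) ^ 20} ∧
      Ideal.span { x : MvPolynomial (Fin 5) ℚ | ∃ i j, x = logJacEx i j } =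
        Ideal.span {(X 0 : MvPolynomial (Fin 5) ℚ) ^ 2} := by
  refine ⟨det_logJacEx, ?_, le_antisymm ?_ ?_⟩
  · rw [minorsIdeal_self, det_logJacEx,
      Ideal.span_singleton_mul_left_unit isUnit_two_mvPolynomial]
  · refine Ideal.span_le.2 ?_
    rintro _ ⟨i, j, rfl⟩
    exact Ideal.mem_span_singleton.2 (X_sq_dvd_logJacEx i j)
  · rw [← Ideal.span_singleton_mul_left_unit isUnit_two_mvPolynomial]
    refine (Ideal.span_singleton_le_iff_mem _).2 (Ideal.subset_span ⟨0, 0, ?_⟩)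
    simp [logJacEx_eq]
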